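/- arXiv:2602.21605 — 2 statements merged into one kernel-verified Lean document; each statement's English description precedes it below -/
import Mathlib

section
/- Let {R_i, t_i : R_i → R_{i+1}}_{i≥0} be a tower (ℕ-indexed inductive system) of commutative rings, and let f ∈ R_0 be an element such that each R_i is f-torsion free and each induced map R_i/fR_i → R_{i+1}/fR_{i+1} is injective. Fix i ≥ 0. If R_{i+1} is integrally closed (respectively, completely integrally closed) in R_{i+1}[1/f], then R_i is integrally closed (respectively, completely integrally closed) in R_i[1/f]. -/
/-- A ring `A` is `g`-torsion free if the only element killed by a positive power
of `g` is zero. -/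
def FTorsionFree {A : Type*} [CommRing A] (g : A) : Prop :=
  ∀ x : A, (∃ n : ℕ, 1 ≤ n ∧ g ^ n * x = 0) → x = 0

/-- `A` is integrally closed in `B` (along the map `φ : A → B`). -/
def IntegrallyClosedIn {A B : Type*} [CommRing A] [CommRing B] (φ : A →+* B) : Prop :=
  ∀ b : B, φ.IsIntegralElem b → ∃ a : A, φ a = b

/-- `b : B` is almost integral over `A` (along `φ : A → B`): all powers of `b`
lie in the `A`-span of some finite subset of `B`. -/
def AlmostIntegralElem {A B : Type*} [CommRing A] [CommRing B] (φ : A →+* B)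
    (b : B) : Prop :=
  ∃ s : Finset B, ∀ n : ℕ, ∃ c : B → A, b ^ n = ∑ x ∈ s, φ (c x) * x

/-- `A` is completely integrally closed in `B` (along `φ : A → B`). -/
def CompletelyIntegrallyClosedIn {A B : Type*} [CommRing A] [CommRing B]
    (φ : A →+* B) : Prop :=
  ∀ b : B, AlmostIntegralElem φ b → ∃ a : A, φ a = b

/-- The image of an element `f ∈ R 0` in the `i`-th layer of a tower of rings. -/
def towerElem (R : ℕ → Type*) [∀ i, CommRing (R i)]
    (t : ∀ i, R i →+* R (i + 1)) (f : R 0) : (i : ℕ) → R i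
  | 0 => f
  | (i + 1) => t i (towerElem R t f i)

theorem AlmostIntegralElem.map {A B A' B' : Type*} [CommRing A] [CommRing B] [CommRing A']
    [CommRing B'] {φ : A →+* B} {φ' : A' →+* B'} {t : A →+* A'} {ψ : B →+* B'}
    (h : ∀ a, ψ (φ a) = φ' (t a)) {b : B} (hb : AlmostIntegralElem φ b) :
    AlmostIntegralElem φ' (ψ b) := by
  classical
  obtain ⟨s, hs⟩ := hb
  refine ⟨s.image ψ, fun n => ?_⟩
  obtain ⟨c, hc⟩ := hs n
  refine ⟨fun y => ∑ x ∈ s with ψ x = y, t (c x), ?_⟩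
  rw [← map_pow, hc, map_sum,
    ← Finset.sum_fiberwise_of_maps_to (fun x hx => Finset.mem_image_of_mem ψ hx)]
  refine Finset.sum_congr rfl fun y _ => ?_
  rw [map_sum, Finset.sum_mul]
  refine Finset.sum_congr rfl fun x hx => ?_
  rw [map_mul, h, (Finset.mem_filter.mp hx).2]

theorem isIntegralElem_of_comm {A B A' B' : Type*} [CommRing A] [CommRing B] [CommRing A']
    [CommRing B'] {φ : A →+* B} {φ' : A' →+* B'} {t : A →+* A'} {ψ : B →+* B'}
    (h : ∀ a, ψ (φ a) = φ' (t a)) {b : B} (hb : φ.IsIntegralElem b) :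
    φ'.IsIntegralElem (ψ b) := by
  obtain ⟨p, hp, hpb⟩ := hb
  refine ⟨p.map t, hp.map _, ?_⟩
  rw [Polynomial.eval₂_map, ← RingHom.ext (f := ψ.comp φ) (g := φ'.comp t) h,
    ← Polynomial.hom_eval₂, hpb, map_zero]

theorem FTorsionFree.pow_mul_eq_zero {A : Type*} [CommRing A] {g : A} (hg : FTorsionFree g)
    {n : ℕ} {x : A} (h : g ^ n * x = 0) : x = 0 :=
  hg x ⟨n + 1, n.succ_pos, by rw [pow_succ', mul_assoc, h, mul_zero]⟩

/-- Divisibility by powers of `g` descends along a map which is injective modulo `g`. -/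
theorem exists_eq_pow_mul_of_map_eq {A A' : Type*} [CommRing A] [CommRing A'] {t : A →+* A'}
    {g : A} (hg : FTorsionFree (t g))
    (hinj : ∀ x : A, (∃ y, t x = t g * y) → ∃ x', x = g * x') (n : ℕ) (x : A) (y : A')
    (h : t x = t g ^ n * y) : ∃ x', x = g ^ n * x' := by
  induction n generalizing x with
  | zero => exact ⟨x, by simp⟩
  | succ n ih =>
    obtain ⟨z, rfl⟩ := hinj x ⟨t g ^ n * y, by rw [h]; ring⟩
    obtain ⟨w, rfl⟩ := ih z (sub_eq_zero.mp (hg.pow_mul_eq_zero (n := 1) (by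
      rw [map_mul] at h
      linear_combination h)))
    exact ⟨w, by ring⟩

/-- If `t` is injective modulo `g`, an element of `A[1/g]` whose image in `A'[1/g]` comes from
`A'` already comes from `A`. -/
theorem exists_algebraMap_eq_of_awayMap {A A' : Type*} [CommRing A] [CommRing A'] {t : A →+* A'}
    {g : A} (hg : FTorsionFree (t g))
    (hinj : ∀ x : A, (∃ y, t x = t g * y) → ∃ x', x = g * x') (b : Localization.Away g)
    (h : ∃ a', algebraMap A' (Localization.Away (t g)) a' = Localization.awayMap t g b) :
    ∃ a, algebraMap A (Localization.Away g) a = b := by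
  obtain ⟨a', ha'⟩ := h
  obtain ⟨n, x, hx⟩ := IsLocalization.Away.surj g b
  have hu : IsUnit (algebraMap A (Localization.Away g) g ^ n) :=
    (IsLocalization.Away.algebraMap_isUnit g).pow n
  have key : algebraMap A' (Localization.Away (t g)) (t x) =
      algebraMap A' (Localization.Away (t g)) (t g ^ n * a') := by
    have := congrArg (Localization.awayMap t g) hx
    simp only [Localization.awayMap, IsLocalization.Away.map, map_mul, map_pow,
      IsLocalization.map_eq] at this ha' ⊢
    rw [← this, ← ha', mul_comm]
  obtain ⟨m, hm⟩ := IsLocalization.Away.exists_of_eq (t g) key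
  have htx : t x = t g ^ n * a' :=
    sub_eq_zero.mp (hg.pow_mul_eq_zero (n := m) (by rw [mul_sub, hm, sub_self]))
  obtain ⟨x', rfl⟩ := exists_eq_pow_mul_of_map_eq hg hinj n x a' htx
  refine ⟨x', hu.mul_left_cancel ?_⟩
  rw [← map_pow, ← map_mul, ← hx, map_pow, mul_comm]

/-- Let `{R_i, t_i}` be a tower of commutative rings and
`f ∈ R_0` such that each `R_i` is `f`-torsion free and each induced map
`R_i/fR_i → R_{i+1}/fR_{i+1}` is injective. If `R_{i+1}` is integrally closed
(resp. completely integrally closed) in `R_{i+1}[1/f]`, then `R_i` is integrally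
closed (resp. completely integrally closed) in `R_i[1/f]`. -/
theorem stmt13 (R : ℕ → Type*) [∀ i, CommRing (R i)]
    (t : ∀ i, R i →+* R (i + 1)) (f : R 0)
    (htf : ∀ i, FTorsionFree (towerElem R t f i))
    -- each induced map `R_i/fR_i → R_{i+1}/fR_{i+1}` is injective
    (hinj : ∀ i (x : R i),
      (∃ y : R (i + 1), t i x = towerElem R t f (i + 1) * y) →
      ∃ x' : R i, x = towerElem R t f i * x')
    (i : ℕ) :
    -- integrally closed descends
    (IntegrallyClosedIn
        (algebraMap (R (i + 1)) (Localization.Away (towerElem R t f (i + 1)))) →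
      IntegrallyClosedIn
        (algebraMap (R i) (Localization.Away (towerElem R t f i)))) ∧
    -- completely integrally closed descends
    (CompletelyIntegrallyClosedIn
        (algebraMap (R (i + 1)) (Localization.Away (towerElem R t f (i + 1)))) →
      CompletelyIntegrallyClosedIn
        (algebraMap (R i) (Localization.Away (towerElem R t f i)))) := by
  have hmap : ∀ a, Localization.awayMap (t i) (towerElem R t f i) (algebraMap _ _ a) =
      algebraMap (R (i + 1)) (Localization.Away (towerElem R t f (i + 1))) (t i a) :=
    fun a => IsLocalization.map_eq _ a
  refine ⟨fun H b hb => ?_, fun H b hb => ?_⟩ <;>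
    refine exists_algebraMap_eq_of_awayMap (htf (i + 1)) (hinj i) b (H _ ?_)
  · exact isIntegralElem_of_comm hmap hb
  · exact hb.map hmap
end

section
/- Let {R_i, t_i : R_i → R_{i+1}}_{i≥0} be a tower (ℕ-indexed inductive system) of commutative rings and f ∈ R_0 an element such that R_i is f-torsion free for every i ∈ ℕ and the colimit R_∞ = colim_i R_i is f-torsion free, and such that each induced map R_i/fR_i → R_{i+1}/fR_{i+1} is injective. Then the following are equivalent: (1) R_i is completely integrally closed in R_i[1/f] for every i ≥ 0; (2) R_∞ is completely integrally closed in R_∞[1/f]; (3) the f-adic completion of R_∞ is completely integrally closed in its localization at f. -/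
/-- Almost integrality of `a / g ^ k` over `A` forces `a / g ^ k ∈ A`, expressed through
divisibility in `A`. -/
def AlmostIntegralDvd {A : Type*} [CommRing A] (g : A) : Prop :=
  ∀ (a : A) (k m : ℕ), (∀ n, g ^ (k * n) ∣ g ^ m * a ^ n) → g ^ k ∣ a

lemma FTorsionFree.mul_left_cancel {A : Type*} [CommRing A] {g : A} (hg : FTorsionFree g)
    (n : ℕ) {x y : A} (h : g ^ n * x = g ^ n * y) : x = y := by
  refine sub_eq_zero.mp (hg _ ⟨n + 1, n.succ_pos, ?_⟩)
  linear_combination g * h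

lemma FTorsionFree.algebraMap_injective {A : Type*} [CommRing A] {g : A}
    (hg : FTorsionFree g) : Function.Injective (algebraMap A (Localization.Away g)) := by
  intro x y h
  obtain ⟨⟨_, n, rfl⟩, hn⟩ := IsLocalization.exists_of_eq (M := Submonoid.powers g) h
  exact hg.mul_left_cancel n hn

/-- For a `g`-torsion free ring `A`, complete integral closedness in `A[1/g]` is a divisibility
condition on `A`. -/
theorem completelyIntegrallyClosedIn_away_iff {A : Type*} [CommRing A] {g : A}
    (hg : FTorsionFree g) :
    CompletelyIntegrallyClosedIn (algebraMap A (Localization.Away g)) ↔ AlmostIntegralDvd g := by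
  classical
  constructor
  · intro H a k m h
    set φ := algebraMap A (Localization.Away g)
    choose d hd using h
    set u : Localization.Away g := IsLocalization.Away.invSelf g
    have hu : φ g * u = 1 := IsLocalization.Away.mul_invSelf g
    have hpow (j : ℕ) : φ g ^ j * u ^ j = 1 := by rw [← mul_pow, hu, one_pow]
    obtain ⟨a', ha'⟩ := H (φ a * u ^ k) ⟨{u ^ m}, fun n => ⟨fun _ => d n, by
      have e := congrArg φ (hd n)
      simp only [map_mul, map_pow] at e
      rw [Finset.sum_singleton, mul_pow, ← pow_mul]
      linear_combination u ^ m * u ^ (k * n) * e - φ a ^ n * u ^ (k * n) * hpow m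
        + φ (d n) * u ^ m * hpow (k * n)⟩⟩
    refine ⟨a', hg.algebraMap_injective ?_⟩
    simp only [map_mul, map_pow]
    linear_combination -φ g ^ k * ha' - φ a * hpow k
  · rintro H b ⟨s, hs⟩
    set φ := algebraMap A (Localization.Away g)
    obtain ⟨k, a, hk⟩ := IsLocalization.Away.surj g b
    obtain ⟨⟨_, m, rfl⟩, hm⟩ :=
      IsLocalization.exist_integer_multiples_of_finset (Submonoid.powers g) s
    have hm' : ∀ x, ∃ y, x ∈ s → φ y = φ g ^ m * x := fun x => by
      by_cases hx : x ∈ s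
      · obtain ⟨y, hy⟩ := hm x hx
        refine ⟨y, fun _ => hy.trans ?_⟩
        simp [Algebra.smul_def, φ]
      · exact ⟨0, fun h => absurd h hx⟩
    choose y hy using hm'
    obtain ⟨a', rfl⟩ := H a k m fun n => by
      obtain ⟨c, hc⟩ := hs n
      refine ⟨∑ x ∈ s, c x * y x, hg.algebraMap_injective ?_⟩
      have e : φ (∑ x ∈ s, c x * y x) = φ g ^ m * b ^ n := by
        rw [hc, map_sum, Finset.mul_sum]
        refine Finset.sum_congr rfl fun x hx => ?_
        rw [map_mul, hy x hx]
        ring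
      change φ _ = φ _
      rw [map_mul, map_mul, e, map_pow, map_pow, map_pow, ← hk, mul_pow, ← pow_mul]
      ring
    refine ⟨a', ?_⟩
    have hunit : IsUnit (φ g ^ k) := (IsLocalization.Away.algebraMap_isUnit g).pow k
    refine hunit.mul_left_cancel ?_
    rw [mul_comm _ b, hk, map_mul, map_pow]

/-- `AlmostIntegralDvd` descends along a ring homomorphism reflecting divisibility by powers. -/
lemma AlmostIntegralDvd.of_map {A B : Type*} [CommRing A] [CommRing B] (φ : A →+* B) {g : A}
    (hφ : ∀ (k : ℕ) (x : A), φ g ^ k ∣ φ x → g ^ k ∣ x) (H : AlmostIntegralDvd (φ g)) :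
    AlmostIntegralDvd g := fun a k m h =>
  hφ k a (H (φ a) k m fun n => by simpa using map_dvd φ (h n))

/-- `AlmostIntegralDvd` ascends along a ring homomorphism which is bijective modulo every power
of `g`. -/
lemma AlmostIntegralDvd.map {A B : Type*} [CommRing A] [CommRing B] (φ : A →+* B) {g : A}
    (hφ : ∀ (k : ℕ) (x : A), φ g ^ k ∣ φ x → g ^ k ∣ x)
    (hsurj : ∀ (k : ℕ) (b : B), ∃ a, φ g ^ k ∣ b - φ a) (H : AlmostIntegralDvd g) :
    AlmostIntegralDvd (φ g) := by
  intro b k m h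
  obtain ⟨a, c, hc⟩ := hsurj k b
  have hmul (i : ℕ) : φ g ^ (k * i) ∣ φ g ^ m * b ^ i := h i
  have ha : g ^ k ∣ a := H a k m fun n => hφ _ _ <| by
    have e : φ a = b + -(φ g ^ k * c) := by rw [← hc]; ring
    rw [map_mul, map_pow, map_pow, e, add_pow, Finset.mul_sum]
    refine Finset.dvd_sum fun i hi => ?_
    have hi' : i + (n - i) = n := by
      have := Finset.mem_range.mp hi
      omega
    have h2 : φ g ^ (k * (n - i)) ∣ (-(φ g ^ k * c)) ^ (n - i) := by
      rw [pow_mul, neg_pow, mul_pow]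
      exact Dvd.dvd.mul_left (Dvd.intro _ rfl) _
    have h3 := (mul_dvd_mul (hmul i) h2).mul_right (n.choose i : B)
    rw [← pow_add, ← mul_add, hi'] at h3
    simpa only [mul_assoc] using h3
  have : φ g ^ k ∣ (b - φ a) + φ a :=
    dvd_add ⟨c, hc⟩ (by simpa using map_dvd φ ha)
  simpa using this

/-- Reflection of divisibility by `g` implies reflection of divisibility by its powers. -/
lemma pow_dvd_of_map_pow_dvd {A B : Type*} [CommRing A] [CommRing B] (φ : A →+* B) {g : A}
    (hg : FTorsionFree (φ g)) (hφ : ∀ x : A, φ g ∣ φ x → g ∣ x) (k : ℕ) :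
    ∀ x : A, φ g ^ k ∣ φ x → g ^ k ∣ x := by
  induction k with
  | zero => simp
  | succ k ih =>
    rintro x ⟨y, hy⟩
    obtain ⟨x', rfl⟩ := hφ x ⟨φ g ^ k * y, by rw [hy]; ring⟩
    rw [pow_succ']
    refine mul_dvd_mul_left g (ih x' ⟨y, hg.mul_left_cancel 1 ?_⟩)
    rw [map_mul] at hy
    linear_combination hy

namespace AdicCompletion

variable {A : Type*} [CommRing A] (g : A)

lemma evalₐ_algebraMap_self (I : Ideal A) (n : ℕ) (x : A) :
    evalₐ I n (algebraMap A (AdicCompletion I A) x) = Ideal.Quotient.mk (I ^ n) x := by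
  simp

lemma pow_dvd_of_algebraMap_pow_dvd (k : ℕ) (x : A)
    (h : algebraMap A (AdicCompletion (Ideal.span {g}) A) g ^ k ∣
      algebraMap A (AdicCompletion (Ideal.span {g}) A) x) : g ^ k ∣ x := by
  have h' := map_dvd (evalₐ (Ideal.span {g}) k) h
  rw [map_pow, evalₐ_algebraMap_self, evalₐ_algebraMap_self, ← map_pow,
    Ideal.Quotient.eq_zero_iff_mem.mpr (by
      rw [Ideal.span_singleton_pow]; exact Ideal.mem_span_singleton_self _), zero_dvd_iff,
    Ideal.Quotient.eq_zero_iff_mem, Ideal.span_singleton_pow, Ideal.mem_span_singleton] at h'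
  exact h'

lemma exists_pow_dvd_sub_algebraMap (k : ℕ) (b : AdicCompletion (Ideal.span {g}) A) :
    ∃ a, algebraMap A (AdicCompletion (Ideal.span {g}) A) g ^ k ∣ b - algebraMap A _ a := by
  obtain ⟨a, ha⟩ := Submodule.mkQ_surjective _ (eval (Ideal.span {g}) A k b)
  refine ⟨a, ?_⟩
  have hker : b - algebraMap A _ a ∈ (eval (Ideal.span {g}) A k).ker := by
    rw [LinearMap.mem_ker, map_sub, ← ha, sub_eq_zero]
    rfl
  rw [← pow_smul_top_eq_ker_eval (Submodule.fg_span_singleton g), Ideal.span_singleton_pow,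
    Submodule.ideal_span_singleton_smul, Submodule.mem_smul_pointwise_iff_exists] at hker
  obtain ⟨c, -, hc⟩ := hker
  exact ⟨c, by rw [← hc, Algebra.smul_def, map_pow]⟩

lemma fTorsionFree_algebraMap (hg : FTorsionFree g) :
    FTorsionFree (algebraMap A (AdicCompletion (Ideal.span {g}) A) g) := by
  rintro x ⟨n, -, hx⟩
  refine ext_evalₐ fun k => ?_
  obtain ⟨a, c, hc⟩ := exists_pow_dvd_sub_algebraMap g (n + k) x
  have hdvd : g ^ (n + k) ∣ g ^ n * a := pow_dvd_of_algebraMap_pow_dvd g _ _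
    ⟨-(algebraMap A _ g ^ n * c), by
      rw [map_mul, map_pow]
      linear_combination hx - algebraMap A _ g ^ n * hc⟩
  obtain ⟨d, hd⟩ := hdvd
  obtain rfl : a = g ^ k * d := hg.mul_left_cancel n (by rw [hd]; ring)
  obtain rfl : x = algebraMap A _ (g ^ k) * (algebraMap A _ g ^ n * c + algebraMap A _ d) := by
    rw [map_mul, map_pow] at hc
    rw [map_pow]
    linear_combination hc
  rw [map_mul, evalₐ_algebraMap_self, Ideal.Quotient.eq_zero_iff_mem.mpr (by
      rw [Ideal.span_singleton_pow]; exact Ideal.mem_span_singleton_self _), zero_mul]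
  exact (_root_.map_zero _).symm

end AdicCompletion

/-- Let `{R_i}` be an ℕ-indexed tower of commutative rings
(presented as an inductive system `t i j : R i →+* R j` for `i ≤ j`) with colimit
`L = R_∞`, and let `f ∈ R_0` be such that every `R_i` and `L` are `f`-torsion
free and each induced map `R_i/fR_i → R_{i+1}/fR_{i+1}` is injective. Then the
following are equivalent: (1) every `R_i` is completely integrally closed in
`R_i[1/f]`; (2) `L` is completely integrally closed in `L[1/f]`; (3) the
`f`-adic completion of `L` is completely integrally closed in its localization
at `f`. -/
theorem stmt14 (R : ℕ → Type*) [∀ i, CommRing (R i)]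
    (t : ∀ i j, i ≤ j → R i →+* R j)
    (ht_id : ∀ i (x : R i), t i i le_rfl x = x)
    (ht_comp : ∀ i j k (hij : i ≤ j) (hjk : j ≤ k) (x : R i),
      t j k hjk (t i j hij x) = t i k (hij.trans hjk) x)
    -- `L` is the colimit `R_∞` of the tower, with structure maps `g i`
    (L : Type*) [CommRing L] (g : ∀ i, R i →+* L)
    (hg : ∀ i j (hij : i ≤ j) (x : R i), g j (t i j hij x) = g i x)
    (hjointsurj : ∀ a : L, ∃ (i : ℕ) (x : R i), g i x = a)
    (heqfactor : ∀ i (x y : R i), g i x = g i y →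
      ∃ (j : ℕ) (hij : i ≤ j), t i j hij x = t i j hij y)
    (f : R 0)
    -- every `R_i` and `L` are `f`-torsion free
    (htf : ∀ i, FTorsionFree (t 0 i (Nat.zero_le i) f))
    (htfL : FTorsionFree (g 0 f))
    -- each induced map `R_i/fR_i → R_{i+1}/fR_{i+1}` is injective
    (hinj : ∀ i (x : R i),
      (∃ y : R (i + 1),
        t i (i + 1) (Nat.le_succ i) x = t 0 (i + 1) (Nat.zero_le _) f * y) →
      ∃ x' : R i, x = t 0 i (Nat.zero_le i) f * x') :
    -- (1) ↔ (2)
    ((∀ i, CompletelyIntegrallyClosedIn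
        (algebraMap (R i) (Localization.Away (t 0 i (Nat.zero_le i) f)))) ↔
      CompletelyIntegrallyClosedIn (algebraMap L (Localization.Away (g 0 f)))) ∧
    -- (2) ↔ (3)
    (CompletelyIntegrallyClosedIn (algebraMap L (Localization.Away (g 0 f))) ↔
      CompletelyIntegrallyClosedIn
        (algebraMap (AdicCompletion (Ideal.span {g 0 f}) L)
          (Localization.Away
            (algebraMap L (AdicCompletion (Ideal.span {g 0 f}) L) (g 0 f))))) := by
  have hdvd_le (i j : ℕ) (hij : i ≤ j) : ∀ x : R i,
      t 0 j (Nat.zero_le j) f ∣ t i j hij x → t 0 i (Nat.zero_le i) f ∣ x := by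
    induction j, hij using Nat.le_induction with
    | base => intro x h; rwa [ht_id] at h
    | succ j hij ih =>
      rintro x ⟨y, hy⟩
      exact ih x (hinj j _ ⟨y, (ht_comp _ _ _ hij (Nat.le_succ j) x).trans hy⟩)
  have hgf (i : ℕ) : g i (t 0 i (Nat.zero_le i) f) = g 0 f := hg _ _ _ _
  have hdvd (i : ℕ) (x : R i) (h : g i (t 0 i (Nat.zero_le i) f) ∣ g i x) :
      t 0 i (Nat.zero_le i) f ∣ x := by
    obtain ⟨y, hy⟩ := h
    obtain ⟨j, z, rfl⟩ := hjointsurj y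
    have hi : i ≤ max i j := le_max_left i j
    have hj : j ≤ max i j := le_max_right i j
    obtain ⟨l, hl, e⟩ := heqfactor (max i j) (t i _ hi x)
      (t 0 _ (Nat.zero_le _) f * t j _ hj z) (by rw [map_mul, hg, hg, hg, hy, hgf])
    refine hdvd_le i l (hi.trans hl) x ⟨t j l (hj.trans hl) z, ?_⟩
    rwa [map_mul, ht_comp, ht_comp, ht_comp] at e
  have hpow (i k : ℕ) : ∀ x : R i,
      g i (t 0 i (Nat.zero_le i) f) ^ k ∣ g i x → t 0 i (Nat.zero_le i) f ^ k ∣ x :=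
    pow_dvd_of_map_pow_dvd (g i) (by rwa [hgf]) (hdvd i) k
  simp only [completelyIntegrallyClosedIn_away_iff (htf _),
    completelyIntegrallyClosedIn_away_iff htfL,
    completelyIntegrallyClosedIn_away_iff (AdicCompletion.fTorsionFree_algebraMap _ htfL)]
  refine ⟨⟨fun H a k m h => ?_, fun H i => ?_⟩, ?_, ?_⟩
  · obtain ⟨i, x, rfl⟩ := hjointsurj a
    have hx := H i x k m fun n => hpow i _ _ (by simpa only [map_mul, map_pow, hgf] using h n)
    simpa only [map_pow, hgf] using map_dvd (g i) hx
  · exact AlmostIntegralDvd.of_map (g i) (hpow i) (by rwa [hgf])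
  · exact AlmostIntegralDvd.map _ (AdicCompletion.pow_dvd_of_algebraMap_pow_dvd _)
      (AdicCompletion.exists_pow_dvd_sub_algebraMap _)
  · exact AlmostIntegralDvd.of_map _ (AdicCompletion.pow_dvd_of_algebraMap_pow_dvd _)
end
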